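/- arXiv:nlin/0512001 — 7 statements merged into one kernel-verified Lean document; each statement's English description precedes it below -/
import Mathlib

section
/- Let K be a field, δ : K → K a derivation (an additive map satisfying δ(xy) = δ(x)y + xδ(y)), n a natural number, and X, a ∈ Mₙ(K). Then there exists a matrix A ∈ Mₙ(K) satisfying δ(X) + A·X − X·a = 0 (δ applied entrywise to X) if and only if for every vector v ∈ Kⁿ with X·v = 0 one also has X·(δ(v) + a·v) = 0, where δ(v) denotes componentwise application; i.e., the equation is solvable for A exactly when the operator v ↦ δ(v) + a·v maps the kernel {v ∈ Kⁿ : Xv = 0} of X into itself. -/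
/-- A linear map `g` on a vector space factors through `f` as soon as `ker f ≤ ker g`. -/
theorem LinearMap.exists_comp_eq_of_ker_le_ker {K V W U : Type*} [Field K]
    [AddCommGroup V] [Module K V] [AddCommGroup W] [Module K W] [AddCommGroup U] [Module K U]
    (f : V →ₗ[K] W) (g : V →ₗ[K] U) (h : LinearMap.ker f ≤ LinearMap.ker g) :
    ∃ k : W →ₗ[K] U, k ∘ₗ f = g := by
  obtain ⟨s, hs⟩ := ((LinearMap.ker f).liftQ f le_rfl).exists_leftInverse_of_injective
    (Submodule.ker_liftQ_eq_bot _ _ _ le_rfl)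
  refine ⟨(LinearMap.ker f).liftQ g h ∘ₗ s, LinearMap.ext fun v => ?_⟩
  have hv : s (f v) = (LinearMap.ker f).mkQ v :=
    LinearMap.congr_fun hs ((LinearMap.ker f).mkQ v)
  simp [hv]

/-- Over a field, `B` is a left multiple of `X` iff every vector killed by `X` is killed by `B`. -/
theorem Matrix.exists_mul_eq_iff_mulVec_eq_zero {K m n l : Type*} [Field K] [Fintype m]
    [Fintype n] [DecidableEq m] [DecidableEq n] (X : Matrix m n K) (B : Matrix l n K) :
    (∃ A : Matrix l m K, A * X = B) ↔ ∀ v : n → K, X.mulVec v = 0 → B.mulVec v = 0 := by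
  constructor
  · rintro ⟨A, rfl⟩ v hv
    rw [← Matrix.mulVec_mulVec, hv, Matrix.mulVec_zero]
  · intro h
    obtain ⟨k, hk⟩ := LinearMap.exists_comp_eq_of_ker_le_ker X.mulVecLin B.mulVecLin
      fun v hv => h v hv
    refine ⟨LinearMap.toMatrix' k, Matrix.ext_of_mulVec_single fun i => ?_⟩
    rw [← Matrix.mulVec_mulVec, LinearMap.toMatrix'_mulVec]
    exact LinearMap.congr_fun hk (Pi.single i 1)

/-- The product rule for an entrywise derivation applied to a matrix-vector product. -/
theorem Matrix.derivation_mulVec {K m n : Type*} [Ring K] [Fintype n] (δ : K → K)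
    (hadd : ∀ x y : K, δ (x + y) = δ x + δ y)
    (hleib : ∀ x y : K, δ (x * y) = δ x * y + x * δ y)
    (X : Matrix m n K) (v : n → K) :
    δ ∘ X.mulVec v = (X.map δ).mulVec v + X.mulVec (δ ∘ v) := by
  funext i
  have hsum := map_sum (AddMonoidHom.mk' δ hadd) (fun j => X i j * v j) Finset.univ
  simp only [AddMonoidHom.mk'_apply] at hsum
  simp [Matrix.mulVec, dotProduct, hsum, hleib, Finset.sum_add_distrib]


/-- **Lemma 1** (solvability of the generalized Laplace invariant equation).
For a field `K` with a derivation `δ`, and matrices `X, a ∈ Mₙ(K)`, the equation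
`δ(X) + A·X − X·a = 0` has a solution `A` iff the operator `v ↦ δ(v) + a·v`
maps the kernel of `X` into itself. -/
theorem laplace_solvability_iff_ker_invariant
    {K : Type*} [Field K] (δ : K → K)
    (hadd : ∀ x y : K, δ (x + y) = δ x + δ y)
    (hleib : ∀ x y : K, δ (x * y) = δ x * y + x * δ y)
    (n : ℕ) (X a : Matrix (Fin n) (Fin n) K) :
    (∃ A : Matrix (Fin n) (Fin n) K, X.map δ + A * X - X * a = 0) ↔
      (∀ v : Fin n → K, X.mulVec v = 0 →
        X.mulVec (fun i => δ (v i) + a.mulVec v i) = 0) := by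
  have hδ : δ 0 = 0 := by simpa using hadd 0 0
  have hker : ∀ v : Fin n → K, X.mulVec v = 0 →
      X.mulVec (fun i => δ (v i) + a.mulVec v i) = (X * a - X.map δ).mulVec v := by
    intro v hv
    have hd := Matrix.derivation_mulVec δ hadd hleib X v
    have hz : δ ∘ X.mulVec v = 0 := by
      funext i
      simp [hv, hδ]
    rw [hz] at hd
    change X.mulVec (δ ∘ v + a.mulVec v) = _
    rw [Matrix.mulVec_add, Matrix.sub_mulVec, Matrix.mulVec_mulVec,
      eq_neg_of_add_eq_zero_right hd.symm]
    abel
  have heq : ∀ A : Matrix (Fin n) (Fin n) K,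
      X.map δ + A * X - X * a = 0 ↔ A * X = X * a - X.map δ := by
    intro A
    rw [sub_eq_zero, eq_sub_iff_add_eq']
  simp only [heq]
  rw [Matrix.exists_mul_eq_iff_mulVec_eq_zero]
  exact forall₂_congr fun v hv => by rw [hker v hv]
end

section
/- Let K be a field, D : K → K a derivation, n a natural number, and b, X ∈ Mₙ(K). Suppose the cokernel of X is invariant under w ↦ D(w) − bᵀ·w, i.e., for every w ∈ Kⁿ with wᵀ·X = 0 one also has (D(w) − bᵀ·w)ᵀ·X = 0, where D acts componentwise. Then for every Δ ∈ Mₙ(K) with Δ·X = 0 one has (D(Δ) + b·Δ − Δ·b)·X = 0 (D applied entrywise to Δ). Consequently, if a and a′ are two matrices with (a − a′)·X = 0, then (D(a) + [b,a])·X = (D(a′) + [b,a′])·X, where [b,a] = b·a − a·b. -/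
open Matrix

/-- **Theorem 1, one-step content.** If the cokernel of `X` is invariant under
`w ↦ D(w) − bᵀ·w`, then every matrix `Δ` with `Δ·X = 0` satisfies
`(D(Δ) + b·Δ − Δ·b)·X = 0`; consequently `(D(a) + [b,a])·X` does not depend on the
choice of `a` modulo matrices annihilating `X`. -/
theorem coker_invariant_implies_invariant_well_defined
    {K : Type*} [Field K] (D : K → K)
    (hadd : ∀ x y : K, D (x + y) = D x + D y)
    (hleib : ∀ x y : K, D (x * y) = D x * y + x * D y)
    (n : ℕ) (b X : Matrix (Fin n) (Fin n) K)
    (hcoker : ∀ w : Fin n → K, Matrix.vecMul w X = 0 →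
      Matrix.vecMul (fun i => D (w i) - Matrix.mulVec bᵀ w i) X = 0) :
    (∀ Δ : Matrix (Fin n) (Fin n) K, Δ * X = 0 →
      (Δ.map D + b * Δ - Δ * b) * X = 0) ∧
    (∀ a a' : Matrix (Fin n) (Fin n) K, (a - a') * X = 0 →
      (a.map D + (b * a - a * b)) * X = (a'.map D + (b * a' - a' * b)) * X) := by
  have key : ∀ Δ : Matrix (Fin n) (Fin n) K, Δ * X = 0 →
      (Δ.map D + b * Δ - Δ * b) * X = 0 := by
    intro Δ hΔ
    have hrows : (Δ.map D - Δ * b) * X = 0 := by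
      funext i
      have hrow : (fun j => D (Δ i j) - (bᵀ *ᵥ Δ i) j) = (Δ.map D - Δ * b) i := by
        funext j
        rw [mulVec_transpose]
        rfl
      have hi := hcoker (Δ i) (congrFun hΔ i)
      rw [hrow] at hi
      exact hi
    rw [add_sub_right_comm, add_mul, hrows, Matrix.mul_assoc, hΔ, Matrix.mul_zero, add_zero]
  refine ⟨key, fun a a' h => ?_⟩
  have hmap : (a - a').map D = a.map D - a'.map D :=
    Matrix.map_sub (AddMonoidHom.mk' D hadd) (map_sub (AddMonoidHom.mk' D hadd)) a a'
  rw [← sub_eq_zero, ← Matrix.sub_mul, ← key (a - a') h, hmap]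
  congr 1
  noncomm_ring
end

section
/- Let u¹, u² : ℝ² → ℝ be smooth. With G₂ = [[2,−1],[−3,2]], P = [[3,1],[0,1/3]], Q = [[1,0],[−1,1]], set S₂ = diag(0, e^{u¹+u²}), S₃ = diag(0, 4e^{2u¹+u²}), S₄ = diag(0, 12e^{3u¹+u²}), S₅ = diag(0, 12e^{3u¹+2u²}) and R₂ = diag(0, ∂_yu¹+∂_yu²), R₃ = diag(0, 2∂_yu¹+∂_yu²), R₄ = diag(0, 3∂_yu¹+∂_yu²), R₅ = diag(0, 3∂_yu¹+2∂_yu²). Then for each m ∈ {2,3,4,5} and for every pair of differentiable functions b₁₁, b₂₁ : ℝ² → ℝ, the matrices X_m := G₂·P⁻¹·S_m·Q and a_m := (−G₂·P⁻¹·R_m + B_m)·P·G₂⁻¹ with B_m = [[b₁₁,0],[b₂₁,0]] satisfy ∂_y X_m + a_m·X_m = 0 at every point (∂_y applied entrywise). -/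
open Matrix

noncomputable section

/-- Entrywise partial derivative with respect to the second variable `y`. -/
def dyMat {n : ℕ} (F : ℝ × ℝ → Matrix (Fin n) (Fin n) ℝ) (p : ℝ × ℝ) :
    Matrix (Fin n) (Fin n) ℝ :=
  Matrix.of fun i j => deriv (fun t => F (p.1, t) i j) p.2

/-- Partial derivative of a scalar function with respect to `y`. -/
def dy (f : ℝ × ℝ → ℝ) (p : ℝ × ℝ) : ℝ := deriv (fun t => f (p.1, t)) p.2

/-- The Cartan matrix `G₂`. -/
def G2M : Matrix (Fin 2) (Fin 2) ℝ := !![2, -1; -3, 2]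

def PM : Matrix (Fin 2) (Fin 2) ℝ := !![3, 1; 0, 1/3]

def QM : Matrix (Fin 2) (Fin 2) ℝ := !![1, 0; -1, 1]

/-- The diagonal matrices `S_m`, `m = 2,…,5`, for the `G₂` Toda lattice. -/
def Sg2 (u1 u2 : ℝ × ℝ → ℝ) (m : ℕ) (p : ℝ × ℝ) : Matrix (Fin 2) (Fin 2) ℝ :=
  match m with
  | 2 => Matrix.diagonal ![0, Real.exp (u1 p + u2 p)]
  | 3 => Matrix.diagonal ![0, 4 * Real.exp (2 * u1 p + u2 p)]
  | 4 => Matrix.diagonal ![0, 12 * Real.exp (3 * u1 p + u2 p)]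
  | 5 => Matrix.diagonal ![0, 12 * Real.exp (3 * u1 p + 2 * u2 p)]
  | _ => 0

/-- The diagonal matrices `R_m`, `m = 2,…,5`, for the `G₂` Toda lattice. -/
def Rg2 (u1 u2 : ℝ × ℝ → ℝ) (m : ℕ) (p : ℝ × ℝ) : Matrix (Fin 2) (Fin 2) ℝ :=
  match m with
  | 2 => Matrix.diagonal ![0, dy u1 p + dy u2 p]
  | 3 => Matrix.diagonal ![0, 2 * dy u1 p + dy u2 p]
  | 4 => Matrix.diagonal ![0, 3 * dy u1 p + dy u2 p]
  | 5 => Matrix.diagonal ![0, 3 * dy u1 p + 2 * dy u2 p]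
  | _ => 0

lemma dyMat_const_mul_diagonal_mul_const (A Q : Matrix (Fin 2) (Fin 2) ℝ) (g : ℝ × ℝ → ℝ)
    (g' : ℝ) (p : ℝ × ℝ) (hg : HasDerivAt (fun t => g (p.1, t)) g' p.2) :
    dyMat (fun q => A * Matrix.diagonal ![0, g q] * Q) p =
      A * Matrix.diagonal ![0, g'] * Q := by
  ext i j
  have h : HasDerivAt (fun t => A i 1 * g (p.1, t) * Q 1 j) (A i 1 * g' * Q 1 j) p.2 :=
    (hg.const_mul _).mul_const _
  simpa [dyMat, Matrix.mul_apply, Fin.sum_univ_two, Matrix.diagonal_apply] using h.deriv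

lemma PM_mul_G2M_inv_mul_cancel : PM * G2M⁻¹ * (G2M * PM⁻¹) = 1 := by
  have hG : IsUnit G2M.det := by
    rw [isUnit_iff_ne_zero]; norm_num [G2M, Matrix.det_fin_two]
  have hP : IsUnit PM.det := by
    rw [isUnit_iff_ne_zero]; norm_num [PM, Matrix.det_fin_two]
  rw [Matrix.mul_assoc, Matrix.nonsing_inv_mul_cancel_left _ _ hG, Matrix.mul_nonsing_inv _ hP]

lemma dyMat_add_mul_eq_zero (g : ℝ × ℝ → ℝ) (r b c : ℝ) (p : ℝ × ℝ)
    (hg : HasDerivAt (fun t => g (p.1, t)) (r * g p) p.2) :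
    dyMat (fun q => G2M * PM⁻¹ * Matrix.diagonal ![0, g q] * QM) p +
      ((-(G2M * PM⁻¹ * Matrix.diagonal ![0, r]) + !![b, 0; c, 0]) * PM * G2M⁻¹) *
        (G2M * PM⁻¹ * Matrix.diagonal ![0, g p] * QM) = 0 := by
  rw [dyMat_const_mul_diagonal_mul_const _ _ g _ p hg]
  have hB : !![b, 0; c, 0] * Matrix.diagonal ![0, g p] = 0 := by
    ext i j; fin_cases i <;> fin_cases j <;> simp
  have hR : Matrix.diagonal ![0, r] * Matrix.diagonal ![0, g p] =
      Matrix.diagonal ![0, r * g p] := by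
    ext i j; fin_cases i <;> fin_cases j <;> simp
  have hX (M : Matrix (Fin 2) (Fin 2) ℝ) :
      M * PM * G2M⁻¹ * (G2M * PM⁻¹ * Matrix.diagonal ![0, g p] * QM) =
        M * Matrix.diagonal ![0, g p] * QM := by
    calc _ = M * (PM * G2M⁻¹ * (G2M * PM⁻¹)) * Matrix.diagonal ![0, g p] * QM := by
          simp only [Matrix.mul_assoc]
      _ = _ := by rw [PM_mul_G2M_inv_mul_cancel, Matrix.mul_one]
  rw [hX, Matrix.add_mul, hB, add_zero, Matrix.neg_mul, Matrix.mul_assoc _ _ (diagonal ![0, g p]),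
    hR, Matrix.neg_mul, add_neg_cancel]

lemma hasDerivAt_dy {u : ℝ × ℝ → ℝ} (hu : Differentiable ℝ u) (p : ℝ × ℝ) :
    HasDerivAt (fun t => u (p.1, t)) (dy u p) p.2 := by
  have h : DifferentiableAt ℝ (fun t => u (p.1, t)) p.2 := by fun_prop
  exact h.hasDerivAt

/-- For each `m ∈ {2,…,5}` and arbitrary differentiable `b₁₁, b₂₁`, the matrices
`X_m = G₂P⁻¹S_mQ` and `a_m = (−G₂P⁻¹R_m + B_m)PG₂⁻¹` satisfy `∂_y X_m + a_m X_m = 0`. -/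
theorem g2_laplace_equation_solutions
    (u1 u2 : ℝ × ℝ → ℝ) (hu1 : ContDiff ℝ (⊤ : ℕ∞) u1) (hu2 : ContDiff ℝ (⊤ : ℕ∞) u2) :
    ∀ m : ℕ, 2 ≤ m → m ≤ 5 →
      ∀ b11 b21 : ℝ × ℝ → ℝ, Differentiable ℝ b11 → Differentiable ℝ b21 →
        ∀ p : ℝ × ℝ,
          dyMat (fun q => G2M * PM⁻¹ * Sg2 u1 u2 m q * QM) p +
            ((-(G2M * PM⁻¹ * Rg2 u1 u2 m p) + !![b11 p, 0; b21 p, 0]) * PM * G2M⁻¹) *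
              (G2M * PM⁻¹ * Sg2 u1 u2 m p * QM) = 0 := by
  intro m hm hm' b11 b21 _ _ p
  have h1 := hasDerivAt_dy (hu1.differentiable (by simp)) p
  have h2 := hasDerivAt_dy (hu2.differentiable (by simp)) p
  interval_cases m
  · refine dyMat_add_mul_eq_zero _ _ _ _ p ?_
    exact (h1.add h2).exp.congr_deriv (mul_comm _ _)
  · refine dyMat_add_mul_eq_zero _ _ _ _ p ?_
    exact (((h1.const_mul 2).add h2).exp.const_mul 4).congr_deriv (by simp; ring)
  · refine dyMat_add_mul_eq_zero _ _ _ _ p ?_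
    exact (((h1.const_mul 3).add h2).exp.const_mul 12).congr_deriv (by simp; ring)
  · refine dyMat_add_mul_eq_zero _ _ _ _ p ?_
    exact (((h1.const_mul 3).add (h2.const_mul 2)).exp.const_mul 12).congr_deriv (by simp; ring)

end
end

section
/- Let u¹, u² : ℝ² → ℝ be smooth solutions of the G₂ Toda lattice ∂²u¹/∂x∂y = 2e^{u¹} − e^{u²}, ∂²u²/∂x∂y = −3e^{u¹} + 2e^{u²}, and let b₁₁, b₂₁ : ℝ² → ℝ be smooth with B₂ = [[b₁₁,0],[b₂₁,0]]. With G₂ = [[2,−1],[−3,2]], P = [[3,1],[0,1/3]], Q = [[1,0],[−1,1]], Z₂ = [[0,0],[−e^{u²}, e^{u¹}]], Z₃ = diag(0, 4e^{u¹}), D₃ = [[0,0],[−(1/3)e^{u²}, 0]], S₂ = diag(0, e^{u¹+u²}), S₃ = diag(0, 4e^{2u¹+u²}), R₂ = diag(0, ∂_yu¹+∂_yu²), define a₂ := (−G₂P⁻¹R₂ + B₂)PG₂⁻¹ and H₃ := ∂_x(a₂) + G₂P⁻¹Z₂G₂⁻¹. Then at every point H₃ = (G₂P⁻¹Z₃ +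 ∂_x(B₂) + G₂P⁻¹D₃)·P·G₂⁻¹, and X₃ := H₃·(G₂P⁻¹S₂Q) = G₂·P⁻¹·S₃·Q. -/
open Matrix

noncomputable section

/-- Entrywise partial derivative with respect to the first variable `x`. -/
def dxMat {n : ℕ} (F : ℝ × ℝ → Matrix (Fin n) (Fin n) ℝ) (p : ℝ × ℝ) :
    Matrix (Fin n) (Fin n) ℝ :=
  Matrix.of fun i j => deriv (fun s => F (s, p.2) i j) p.1

lemma PM_inv : PM⁻¹ = !![1/3, -1; 0, 3] := by
  apply Matrix.inv_eq_right_inv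
  ext i j
  fin_cases i <;> fin_cases j <;> norm_num [PM, Matrix.mul_apply, Fin.sum_univ_two]

lemma G2M_inv : G2M⁻¹ = !![2, 1; 3, 2] := by
  apply Matrix.inv_eq_right_inv
  ext i j
  fin_cases i <;> fin_cases j <;> norm_num [G2M, Matrix.mul_apply, Fin.sum_univ_two]

lemma diagonal_zero_cons (a : ℝ) : Matrix.diagonal ![0, a] = !![0, 0; 0, a] := by
  ext i j
  fin_cases i <;> fin_cases j <;> simp

/-- The `y`-derivative of a smooth function is differentiable along `x`. -/
lemma differentiable_dy_slice {u : ℝ × ℝ → ℝ} (hu : ContDiff ℝ (⊤ : ℕ∞) u) (y : ℝ) :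
    Differentiable ℝ fun s => dy u (s, y) := by
  have hdy : (fun s => dy u (s, y)) = fun s => fderiv ℝ u (s, y) (0, 1) := by
    funext s
    have hslice : HasDerivAt (fun t : ℝ => (s, t)) ((0 : ℝ), (1 : ℝ)) y :=
      (hasDerivAt_const y s).prodMk (hasDerivAt_id y)
    have hdiff : DifferentiableAt ℝ u (s, y) := hu.differentiable (by simp) _
    exact (hdiff.hasFDerivAt.comp_hasDerivAt y hslice).deriv
  have hfderiv : Differentiable ℝ (fderiv ℝ u) :=
    (hu.fderiv_right (m := (⊤ : ℕ∞)) (by simp)).differentiable (by simp)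
  rw [hdy]
  fun_prop

/-- Smooth functions are differentiable along `x`. -/
lemma differentiable_slice {b : ℝ × ℝ → ℝ} (hb : ContDiff ℝ (⊤ : ℕ∞) b) (y : ℝ) :
    Differentiable ℝ fun s => b (s, y) := by
  have hdiff : Differentiable ℝ b := hb.differentiable (by simp)
  fun_prop

/-- Right multiplication by a constant matrix commutes with `dxMat`. -/
lemma dxMat_mul_const {n : ℕ} (F : ℝ × ℝ → Matrix (Fin n) (Fin n) ℝ)
    (M : Matrix (Fin n) (Fin n) ℝ) (p : ℝ × ℝ)
    (hF : ∀ i j, DifferentiableAt ℝ (fun s => F (s, p.2) i j) p.1) :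
    dxMat (fun q => F q * M) p = dxMat F p * M := by
  ext i j
  simp only [dxMat, Matrix.of_apply, Matrix.mul_apply]
  rw [deriv_fun_sum fun k _ => (hF i k).mul_const _]
  exact Finset.sum_congr rfl fun k _ => deriv_mul_const (hF i k) _

/-- Left multiplication by a constant matrix commutes with `dxMat`. -/
lemma dxMat_const_mul {n : ℕ} (F : ℝ × ℝ → Matrix (Fin n) (Fin n) ℝ)
    (M : Matrix (Fin n) (Fin n) ℝ) (p : ℝ × ℝ)
    (hF : ∀ i j, DifferentiableAt ℝ (fun s => F (s, p.2) i j) p.1) :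
    dxMat (fun q => M * F q) p = M * dxMat F p := by
  ext i j
  simp only [dxMat, Matrix.of_apply, Matrix.mul_apply]
  rw [deriv_fun_sum fun k _ => (hF k j).const_mul _]
  exact Finset.sum_congr rfl fun k _ => deriv_const_mul _ (hF k j)

/-- `dxMat` of `-F + G`. -/
lemma dxMat_neg_add {n : ℕ} (F G : ℝ × ℝ → Matrix (Fin n) (Fin n) ℝ) (p : ℝ × ℝ)
    (hF : ∀ i j, DifferentiableAt ℝ (fun s => F (s, p.2) i j) p.1)
    (hG : ∀ i j, DifferentiableAt ℝ (fun s => G (s, p.2) i j) p.1) :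
    dxMat (fun q => -F q + G q) p = -dxMat F p + dxMat G p := by
  ext i j
  simp only [dxMat, Matrix.of_apply, Matrix.add_apply, Matrix.neg_apply]
  rw [deriv_fun_add (hF i j).fun_neg (hG i j), deriv.fun_neg]

/-- For smooth solutions of the `G₂` Toda lattice and any admissible `B₂`,
`H₃ = ∂_x(a₂) + G₂P⁻¹Z₂G₂⁻¹` equals `(G₂P⁻¹Z₃ + ∂_x(B₂) + G₂P⁻¹D₃)PG₂⁻¹`, and
`X₃ = H₃·(G₂P⁻¹S₂Q) = G₂P⁻¹S₃Q`. -/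
theorem g2_third_laplace_invariant
    (u1 u2 : ℝ × ℝ → ℝ) (hu1 : ContDiff ℝ (⊤ : ℕ∞) u1) (hu2 : ContDiff ℝ (⊤ : ℕ∞) u2)
    (hpde1 : ∀ x y : ℝ, deriv (fun s => deriv (fun t => u1 (s, t)) y) x =
      2 * Real.exp (u1 (x, y)) - Real.exp (u2 (x, y)))
    (hpde2 : ∀ x y : ℝ, deriv (fun s => deriv (fun t => u2 (s, t)) y) x =
      -3 * Real.exp (u1 (x, y)) + 2 * Real.exp (u2 (x, y)))
    (b11 b21 : ℝ × ℝ → ℝ) (hb11 : ContDiff ℝ (⊤ : ℕ∞) b11) (hb21 : ContDiff ℝ (⊤ : ℕ∞) b21) :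
    ∀ p : ℝ × ℝ,
      dxMat (fun q =>
          (-(G2M * PM⁻¹ * Matrix.diagonal ![0, dy u1 q + dy u2 q]) +
            !![b11 q, 0; b21 q, 0]) * PM * G2M⁻¹) p +
          G2M * PM⁻¹ * !![0, 0; -Real.exp (u2 p), Real.exp (u1 p)] * G2M⁻¹ =
        (G2M * PM⁻¹ * Matrix.diagonal ![0, 4 * Real.exp (u1 p)] +
            dxMat (fun q => !![b11 q, 0; b21 q, 0]) p +
            G2M * PM⁻¹ * !![0, 0; -(1/3) * Real.exp (u2 p), 0]) * PM * G2M⁻¹ ∧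
      (dxMat (fun q =>
          (-(G2M * PM⁻¹ * Matrix.diagonal ![0, dy u1 q + dy u2 q]) +
            !![b11 q, 0; b21 q, 0]) * PM * G2M⁻¹) p +
          G2M * PM⁻¹ * !![0, 0; -Real.exp (u2 p), Real.exp (u1 p)] * G2M⁻¹) *
          (G2M * PM⁻¹ * Matrix.diagonal ![0, Real.exp (u1 p + u2 p)] * QM) =
        G2M * PM⁻¹ * Matrix.diagonal ![0, 4 * Real.exp (2 * u1 p + u2 p)] * QM := by
  intro p
  obtain ⟨x, y⟩ := p
  have hw1 := differentiable_dy_slice hu1 y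
  have hw2 := differentiable_dy_slice hu2 y
  have hb1 := differentiable_slice hb11 y
  have hb2 := differentiable_slice hb21 y
  have hR : ∀ i j, DifferentiableAt ℝ
      (fun s => Matrix.diagonal ![0, dy u1 (s, y) + dy u2 (s, y)] i j) x := by
    intro i j
    fin_cases i <;> fin_cases j <;> simp [Matrix.diagonal]
    exact (hw1 x).add (hw2 x)
  have hB : ∀ i j, DifferentiableAt ℝ
      (fun s => (!![b11 (s, y), 0; b21 (s, y), 0] : Matrix (Fin 2) (Fin 2) ℝ) i j) x := by
    intro i j
    fin_cases i <;> fin_cases j <;> simp [hb1 x, hb2 x]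
  have hCR : ∀ i j, DifferentiableAt ℝ (fun s => (G2M * PM⁻¹ *
      Matrix.diagonal ![0, dy u1 (s, y) + dy u2 (s, y)]) i j) x := by
    intro i j
    simp only [Matrix.mul_apply (M := G2M * PM⁻¹)]
    exact DifferentiableAt.fun_sum fun k _ => (hR k j).const_mul _
  have hRx : dxMat (fun q => Matrix.diagonal ![0, dy u1 q + dy u2 q]) (x, y) =
      Matrix.diagonal ![0, Real.exp (u2 (x, y)) - Real.exp (u1 (x, y))] := by
    have hw : deriv (fun s => dy u1 (s, y) + dy u2 (s, y)) x =
        Real.exp (u2 (x, y)) - Real.exp (u1 (x, y)) := by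
      rw [deriv_fun_add (hw1 x) (hw2 x)]
      have h1 : deriv (fun s => dy u1 (s, y)) x = _ := hpde1 x y
      have h2 : deriv (fun s => dy u2 (s, y)) x = _ := hpde2 x y
      rw [h1, h2]
      ring
    ext i j
    fin_cases i <;> fin_cases j <;> simp [dxMat, Matrix.diagonal, hw]
  have hBx : dxMat (fun q => !![b11 q, 0; b21 q, 0]) (x, y) =
      !![deriv (fun s => b11 (s, y)) x, 0; deriv (fun s => b21 (s, y)) x, 0] := by
    ext i j
    fin_cases i <;> fin_cases j <;> simp [dxMat]
  have hS : ∀ i j, DifferentiableAt ℝ (fun s => (-(G2M * PM⁻¹ *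
      Matrix.diagonal ![0, dy u1 (s, y) + dy u2 (s, y)]) +
      !![b11 (s, y), 0; b21 (s, y), 0]) i j) x :=
    fun i j => (hCR i j).fun_neg.fun_add (hB i j)
  have ha : dxMat (fun q =>
      (-(G2M * PM⁻¹ * Matrix.diagonal ![0, dy u1 q + dy u2 q]) +
        !![b11 q, 0; b21 q, 0]) * PM * G2M⁻¹) (x, y) =
      (-(G2M * PM⁻¹ * Matrix.diagonal ![0, Real.exp (u2 (x, y)) - Real.exp (u1 (x, y))]) +
        !![deriv (fun s => b11 (s, y)) x, 0; deriv (fun s => b21 (s, y)) x, 0]) *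
        PM * G2M⁻¹ := by
    simp only [Matrix.mul_assoc _ PM G2M⁻¹]
    rw [dxMat_mul_const _ _ _ hS, dxMat_neg_add _ _ _ hCR hB, dxMat_const_mul _ _ _ hR, hRx, hBx]
  have he : Real.exp (2 * u1 (x, y) + u2 (x, y)) =
      Real.exp (u1 (x, y)) * Real.exp (u1 (x, y)) * Real.exp (u2 (x, y)) := by
    rw [← Real.exp_add, ← Real.exp_add]
    ring_nf
  rw [ha, hBx, PM_inv, G2M_inv, he, Real.exp_add]
  simp only [diagonal_zero_cons]
  constructor <;> ext i j <;> fin_cases i <;> fin_cases j <;>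
    simp [G2M, PM, QM, Matrix.mul_apply, Fin.sum_univ_two] <;> ring

end
end

section
/- Let u¹, u² : ℝ² → ℝ be arbitrary functions. With G₂ = [[2,−1],[−3,2]], P = [[3,1],[0,1/3]], Q = [[1,0],[−1,1]], U = diag(e^{u¹}, e^{u²}), and S_m for m = 2,…,5 given by S₂ = diag(0, e^{u¹+u²}), S₃ = diag(0, 4e^{2u¹+u²}), S₄ = diag(0, 12e^{3u¹+u²}), S₅ = diag(0, 12e^{3u¹+2u²}): at every point (x,y), the matrix X₁ = G₂·U has rank 2, and for each m ∈ {2,3,4,5} the matrix X_m = G₂·P⁻¹·S_m·Q has rank 1. Hence along the chain X₁,…,X₅, X₆ = 0 of generalized Laplace invariants of the G₂ Toda lattice, the rank drops exactly at m = 2 and m = 6, i.e., immediately after the indices 1 and 5, which are the exponents of G₂, and the chain terminates at the Coxeter number 6. -/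
open Matrix

noncomputable section

theorem isUnit_det_G2M : IsUnit G2M.det := by
  norm_num [G2M, det_fin_two]

theorem isUnit_det_PM : IsUnit PM.det := by
  norm_num [PM, det_fin_two]

theorem isUnit_det_QM : IsUnit QM.det := by
  norm_num [QM, det_fin_two]

theorem isUnit_det_G2M_mul_inv_PM : IsUnit (G2M * PM⁻¹).det := by
  rw [det_mul]
  exact isUnit_det_G2M.mul (isUnit_nonsing_inv_det PM isUnit_det_PM)

theorem rank_diagonal_zero_left {c : ℝ} (hc : c ≠ 0) :
    (Matrix.diagonal ![0, c]).rank = 1 := by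
  rw [rank_diagonal, Fintype.card_subtype, Finset.card_eq_one]
  refine ⟨1, ?_⟩
  ext i
  fin_cases i <;> simp [hc]

theorem rank_Sg2 (u1 u2 : ℝ × ℝ → ℝ) (p : ℝ × ℝ) {m : ℕ} (h2 : 2 ≤ m) (h5 : m ≤ 5) :
    (Sg2 u1 u2 m p).rank = 1 := by
  interval_cases m <;> exact rank_diagonal_zero_left (by positivity)

/-- **Ranks along the `G₂` Laplace chain.** `X₁ = G₂U` has rank `2` and the
invariants `X_m = G₂P⁻¹S_mQ`, `m = 2,…,5`, have rank `1` at every point: the rank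
drops exactly after the exponents `1, 5` of `G₂`, and the chain terminates at the
Coxeter number `6`. -/
theorem g2_laplace_invariant_ranks (u1 u2 : ℝ × ℝ → ℝ) :
    ∀ p : ℝ × ℝ,
      (G2M * Matrix.diagonal ![Real.exp (u1 p), Real.exp (u2 p)]).rank = 2 ∧
      ∀ m : ℕ, 2 ≤ m → m ≤ 5 →
        (G2M * PM⁻¹ * Sg2 u1 u2 m p * QM).rank = 1 := by
  refine fun p => ⟨?_, fun m h2 h5 => ?_⟩
  · rw [rank_mul_eq_right_of_isUnit_det _ _ isUnit_det_G2M, rank_of_isUnit]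
    · simp
    · rw [isUnit_iff_isUnit_det]
      simp [det_diagonal]
  · rw [rank_mul_eq_left_of_isUnit_det _ _ isUnit_det_QM,
      rank_mul_eq_right_of_isUnit_det _ _ isUnit_det_G2M_mul_inv_PM, rank_Sg2 u1 u2 p h2 h5]

end
end

section
/- Let u¹,…,u⁶ : ℝ² → ℝ be smooth solutions of the E₆ Toda lattice: u¹_xy = 2e^{u¹} − e^{u³}, u²_xy = 2e^{u²} − e^{u⁴}, u³_xy = −e^{u¹} + 2e^{u³} − e^{u⁴}, u⁴_xy = −e^{u²} − e^{u³} + 2e^{u⁴} − e^{u⁵}, u⁵_xy = −e^{u⁴} + 2e^{u⁵} − e^{u⁶}, u⁶_xy = −e^{u⁵} + 2e^{u⁶}. Let C denote the corresponding 6×6 coefficient matrix (the E₆ Cartan matrix, with rows (2,0,−1,0,0,0), (0,2,0,−1,0,0), (−1,0,2,−1,0,0), (0,−1,−1,2,−1,0), (0,0,0,−1,2,−1), (0,0,0,0,−1,2)). Let J₆ be the 6×6 upper-triangular all-ones matrix, P₂ the 6×6 matrix equal to the identity except that its third row is (0,−1,1,0,0,0) and its fourth row is (0,1,−1,1,0,0),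 and A₂ = J₆⁻¹·P₂⁻¹. Let U = diag(e^{u¹},…,e^{u⁶}), R₁ = diag(∂_yu¹,…,∂_yu⁶), S₂ = diag(0, e^{u¹+u³}, e^{u²+u⁴}, e^{u³+u⁴}, e^{u⁴+u⁵}, e^{u⁵+u⁶}), and let Z₂ be the 6×6 matrix with first row zero and rows 2–6 equal to (−e^{u³}, 0, e^{u¹}, 0, 0, 0), (0, −e^{u⁴}, 0, e^{u²}, 0, 0), (0, 0, −e^{u⁴}, e^{u³}, 0, 0), (0, 0, 0, −e^{u⁵}, e^{u⁴}, 0), (0, 0, 0, 0, −e^{u⁶}, e^{u⁵}). Define H₂ := ∂_x(−C·R₁·C⁻¹) + C·U (∂_x entrywise). Then at every point H₂ = C·A₂·Z₂·C⁻¹ and X₂ := H₂·(C·U) = C·A₂·S₂·A₂ᵀ. -/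
open Matrix

noncomputable section

/-- The Cartan matrix `E₆` (in the ordering used in the paper). -/
def E6M : Matrix (Fin 6) (Fin 6) ℝ :=
  !![2, 0, -1, 0, 0, 0;
     0, 2, 0, -1, 0, 0;
     -1, 0, 2, -1, 0, 0;
     0, -1, -1, 2, -1, 0;
     0, 0, 0, -1, 2, -1;
     0, 0, 0, 0, -1, 2]

/-- The `6 × 6` upper-triangular all-ones matrix `J₆`. -/
def J6 : Matrix (Fin 6) (Fin 6) ℝ := Matrix.of fun i j => if i ≤ j then 1 else 0

/-- The matrix `P₂` for `E₆`. -/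
def P2e6 : Matrix (Fin 6) (Fin 6) ℝ :=
  !![1, 0, 0, 0, 0, 0;
     0, 1, 0, 0, 0, 0;
     0, -1, 1, 0, 0, 0;
     0, 1, -1, 1, 0, 0;
     0, 0, 0, 0, 1, 0;
     0, 0, 0, 0, 0, 1]

/-- `A₂ = J₆⁻¹·P₂⁻¹`. -/
def A2e6 : Matrix (Fin 6) (Fin 6) ℝ := J6⁻¹ * P2e6⁻¹

lemma differentiable_dy {f : ℝ × ℝ → ℝ} (hf : ContDiff ℝ (⊤ : ℕ∞) f) :
    Differentiable ℝ (dy f) := by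
  have h : dy f = fun q => fderiv ℝ f q (0, 1) := by
    ext q
    have hq : HasDerivAt (fun t : ℝ => (q.1, t)) (0, 1) q.2 :=
      (hasDerivAt_const _ _).prodMk (hasDerivAt_id _)
    exact (((hf.differentiable (by simp)) (q.1, q.2)).hasFDerivAt.comp_hasDerivAt q.2 hq).deriv
  rw [h]
  exact ((hf.fderiv_right (m := (1 : ℕ∞)) (WithTop.coe_le_coe.mpr le_top)).differentiable
    (by simp)).clm_apply (differentiable_const _)

/-- Entrywise `x`-derivative of `-(A * diag (∂_y u) * B)` for smooth `u` and constant `A`, `B`. -/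
lemma dxMat_neg_mul_diagonal_dy_mul {n : ℕ} (A B : Matrix (Fin n) (Fin n) ℝ)
    (u : Fin n → ℝ × ℝ → ℝ) (hu : ∀ k, ContDiff ℝ (⊤ : ℕ∞) (u k)) (p : ℝ × ℝ) :
    dxMat (fun q => -(A * diagonal (fun k => dy (u k) q) * B)) p =
      -(A * diagonal (fun k => deriv (fun s => dy (u k) (s, p.2)) p.1) * B) := by
  ext i j
  have hentry (r : Fin n → ℝ) :
      (-(A * diagonal r * B)) i j = -∑ k, A i k * r k * B k j := by
    simp [mul_apply (N := B)]
  simp only [dxMat, of_apply, hentry]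
  have hd (k : Fin n) : DifferentiableAt ℝ (fun s => dy (u k) (s, p.2)) p.1 :=
    (differentiable_dy (hu k)).differentiableAt.comp p.1 (by fun_prop)
  exact (HasDerivAt.fun_sum fun k _ =>
    ((hd k).hasDerivAt.const_mul (A i k)).mul_const (B k j)).neg.deriv

lemma isUnit_det_E6M : IsUnit E6M.det := by
  refine isUnit_det_of_right_inverse (B := !![
       4/3, 1, 5/3, 2, 4/3, 2/3;
       1, 2, 2, 3, 2, 1;
       5/3, 2, 10/3, 4, 8/3, 4/3;
       2, 3, 4, 6, 4, 2;
       4/3, 2, 8/3, 4, 10/3, 5/3;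
       2/3, 1, 4/3, 2, 5/3, 4/3]) ?_
  ext i j
  fin_cases i <;> fin_cases j <;>
    norm_num [E6M, mul_apply, Fin.sum_univ_succ]

lemma det_J6 : J6.det = 1 := by
  rw [det_of_isUpperTriangular (fun i j (hij : j < i) => by simp [J6, hij])]
  simp [J6]

lemma det_P2e6 : P2e6.det = 1 := by
  rw [det_of_isLowerTriangular _ (fun i j (hij : i < j) => by
    revert hij; fin_cases i <;> fin_cases j <;> simp [P2e6])]
  simp [P2e6, Fin.prod_univ_succ]

lemma A2e6_mul_P2e6_mul_J6 : A2e6 * (P2e6 * J6) = 1 := by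
  rw [A2e6, Matrix.mul_assoc, nonsing_inv_mul_cancel_left _ _ (by simp [det_P2e6]),
    nonsing_inv_mul _ (by simp [det_J6])]

lemma P2e6_mul_J6 : P2e6 * J6 =
    !![1, 1, 1, 1, 1, 1;
       0, 1, 1, 1, 1, 1;
       0, -1, 0, 0, 0, 0;
       0, 1, 0, 1, 1, 1;
       0, 0, 0, 0, 1, 1;
       0, 0, 0, 0, 0, 1] := by
  ext i j
  fin_cases i <;> fin_cases j <;>
    simp [P2e6, J6, mul_apply, Fin.sum_univ_six]

/-- The matrix `Z₂` in terms of `v i = exp (u i)`. -/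
def Z2e6 (v : Fin 6 → ℝ) : Matrix (Fin 6) (Fin 6) ℝ :=
  !![0, 0, 0, 0, 0, 0;
     -v 2, 0, v 0, 0, 0, 0;
     0, -v 3, 0, v 1, 0, 0;
     0, 0, -v 3, v 2, 0, 0;
     0, 0, 0, -v 4, v 3, 0;
     0, 0, 0, 0, -v 5, v 4]

lemma E6M_mulVec (v : Fin 6 → ℝ) :
    E6M *ᵥ v = ![2 * v 0 - v 2, 2 * v 1 - v 3, -v 0 + 2 * v 2 - v 3,
      -v 1 - v 2 + 2 * v 3 - v 4, -v 3 + 2 * v 4 - v 5, -v 4 + 2 * v 5] := by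
  ext i
  fin_cases i <;> simp [E6M, mulVec, dotProduct, Fin.sum_univ_six] <;> ring

lemma diagonal_mul_E6M_sub (v : Fin 6 → ℝ) :
    diagonal v * E6M - diagonal (E6M *ᵥ v) = A2e6 * Z2e6 v := by
  have h : P2e6 * J6 * (diagonal v * E6M - diagonal (E6M *ᵥ v)) = Z2e6 v := by
    rw [P2e6_mul_J6, E6M_mulVec]
    ext i j
    fin_cases j <;> fin_cases i <;>
      simp [Z2e6, E6M, mul_apply, Fin.sum_univ_six, diagonal_apply] <;> ring
  rw [← h, ← Matrix.mul_assoc, A2e6_mul_P2e6_mul_J6, Matrix.one_mul]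

lemma Z2e6_mul_diagonal (v : Fin 6 → ℝ) :
    Z2e6 v * diagonal v =
      diagonal ![0, v 0 * v 2, v 1 * v 3, v 2 * v 3, v 3 * v 4, v 4 * v 5] * A2e6ᵀ := by
  have h : Z2e6 v * diagonal v * (P2e6 * J6)ᵀ =
      diagonal ![0, v 0 * v 2, v 1 * v 3, v 2 * v 3, v 3 * v 4, v 4 * v 5] := by
    rw [P2e6_mul_J6]
    ext i j
    fin_cases i <;> fin_cases j <;>
      simp [Z2e6, mul_apply, vecMul_diagonal, Fin.sum_univ_six] <;> ring
  rw [← h, Matrix.mul_assoc, ← transpose_mul, A2e6_mul_P2e6_mul_J6, transpose_one, Matrix.mul_one]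

/-- If `D = diag (C v)`, then `-(C D C⁻¹) + C diag v = C A₂ Z₂ C⁻¹` for the Cartan matrix `C`. -/
lemma neg_E6M_conj_add (v : Fin 6 → ℝ) :
    -(E6M * diagonal (E6M *ᵥ v) * E6M⁻¹) + E6M * diagonal v =
      E6M * A2e6 * Z2e6 v * E6M⁻¹ := by
  rw [Matrix.mul_assoc E6M A2e6, ← diagonal_mul_E6M_sub, Matrix.mul_sub, Matrix.sub_mul,
    ← Matrix.mul_assoc, mul_nonsing_inv_cancel_right _ _ isUnit_det_E6M]
  abel

/-- For smooth solutions of the `E₆` Toda lattice, `H₂ = ∂_x(−CR₁C⁻¹) + CU` equals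
`C·A₂·Z₂·C⁻¹` and `X₂ = H₂·(CU) = C·A₂·S₂·A₂ᵀ`. -/
theorem e6_second_laplace_invariant
    (u1 u2 u3 u4 u5 u6 : ℝ × ℝ → ℝ)
    (hu1 : ContDiff ℝ (⊤ : ℕ∞) u1) (hu2 : ContDiff ℝ (⊤ : ℕ∞) u2) (hu3 : ContDiff ℝ (⊤ : ℕ∞) u3)
    (hu4 : ContDiff ℝ (⊤ : ℕ∞) u4) (hu5 : ContDiff ℝ (⊤ : ℕ∞) u5) (hu6 : ContDiff ℝ (⊤ : ℕ∞) u6)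
    (hpde1 : ∀ x y : ℝ, deriv (fun s => deriv (fun t => u1 (s, t)) y) x =
      2 * Real.exp (u1 (x, y)) - Real.exp (u3 (x, y)))
    (hpde2 : ∀ x y : ℝ, deriv (fun s => deriv (fun t => u2 (s, t)) y) x =
      2 * Real.exp (u2 (x, y)) - Real.exp (u4 (x, y)))
    (hpde3 : ∀ x y : ℝ, deriv (fun s => deriv (fun t => u3 (s, t)) y) x =
      -Real.exp (u1 (x, y)) + 2 * Real.exp (u3 (x, y)) - Real.exp (u4 (x, y)))
    (hpde4 : ∀ x y : ℝ, deriv (fun s => deriv (fun t => u4 (s, t)) y) x =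
      -Real.exp (u2 (x, y)) - Real.exp (u3 (x, y)) + 2 * Real.exp (u4 (x, y)) -
        Real.exp (u5 (x, y)))
    (hpde5 : ∀ x y : ℝ, deriv (fun s => deriv (fun t => u5 (s, t)) y) x =
      -Real.exp (u4 (x, y)) + 2 * Real.exp (u5 (x, y)) - Real.exp (u6 (x, y)))
    (hpde6 : ∀ x y : ℝ, deriv (fun s => deriv (fun t => u6 (s, t)) y) x =
      -Real.exp (u5 (x, y)) + 2 * Real.exp (u6 (x, y))) :
    ∀ p : ℝ × ℝ,
      dxMat (fun q =>
          -(E6M * Matrix.diagonal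
              ![dy u1 q, dy u2 q, dy u3 q, dy u4 q, dy u5 q, dy u6 q] * E6M⁻¹)) p +
          E6M * Matrix.diagonal ![Real.exp (u1 p), Real.exp (u2 p), Real.exp (u3 p),
            Real.exp (u4 p), Real.exp (u5 p), Real.exp (u6 p)] =
        E6M * A2e6 *
          !![0, 0, 0, 0, 0, 0;
             -Real.exp (u3 p), 0, Real.exp (u1 p), 0, 0, 0;
             0, -Real.exp (u4 p), 0, Real.exp (u2 p), 0, 0;
             0, 0, -Real.exp (u4 p), Real.exp (u3 p), 0, 0;
             0, 0, 0, -Real.exp (u5 p), Real.exp (u4 p), 0;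
             0, 0, 0, 0, -Real.exp (u6 p), Real.exp (u5 p)] * E6M⁻¹ ∧
      (dxMat (fun q =>
          -(E6M * Matrix.diagonal
              ![dy u1 q, dy u2 q, dy u3 q, dy u4 q, dy u5 q, dy u6 q] * E6M⁻¹)) p +
          E6M * Matrix.diagonal ![Real.exp (u1 p), Real.exp (u2 p), Real.exp (u3 p),
            Real.exp (u4 p), Real.exp (u5 p), Real.exp (u6 p)]) *
          (E6M * Matrix.diagonal ![Real.exp (u1 p), Real.exp (u2 p), Real.exp (u3 p),
            Real.exp (u4 p), Real.exp (u5 p), Real.exp (u6 p)]) =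
        E6M * A2e6 *
          Matrix.diagonal ![0, Real.exp (u1 p + u3 p), Real.exp (u2 p + u4 p),
            Real.exp (u3 p + u4 p), Real.exp (u4 p + u5 p), Real.exp (u5 p + u6 p)] *
          A2e6ᵀ := by
  intro p
  set v : Fin 6 → ℝ := ![Real.exp (u1 p), Real.exp (u2 p), Real.exp (u3 p),
    Real.exp (u4 p), Real.exp (u5 p), Real.exp (u6 p)]
  have hdy (q : ℝ × ℝ) : ![dy u1 q, dy u2 q, dy u3 q, dy u4 q, dy u5 q, dy u6 q] =
      fun k => dy (![u1, u2, u3, u4, u5, u6] k) q := by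
    ext k; fin_cases k <;> rfl
  have hmixed : (fun k => deriv (fun s => dy (![u1, u2, u3, u4, u5, u6] k) (s, p.2)) p.1) =
      E6M *ᵥ v := by
    rw [E6M_mulVec]
    ext k
    fin_cases k
    exacts [hpde1 p.1 p.2, hpde2 p.1 p.2, hpde3 p.1 p.2, hpde4 p.1 p.2, hpde5 p.1 p.2,
      hpde6 p.1 p.2]
  have hu (k : Fin 6) : ContDiff ℝ (⊤ : ℕ∞) (![u1, u2, u3, u4, u5, u6] k) := by
    fin_cases k <;> assumption
  simp only [hdy]
  rw [dxMat_neg_mul_diagonal_dy_mul _ _ _ hu, hmixed, neg_E6M_conj_add]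
  refine ⟨rfl, ?_⟩
  rw [← Matrix.mul_assoc, nonsing_inv_mul_cancel_right _ _ isUnit_det_E6M, Matrix.mul_assoc,
    Z2e6_mul_diagonal, ← Matrix.mul_assoc]
  simp only [Real.exp_add]
  rfl

end
end

section
/- Let u¹,…,u⁸ : ℝ² → ℝ be smooth solutions of the E₈ Toda lattice: u¹_xy = 2e^{u¹} − e^{u³}, u²_xy = 2e^{u²} − e^{u⁴}, u³_xy = −e^{u¹} + 2e^{u³} − e^{u⁴}, u⁴_xy = −e^{u²} − e^{u³} + 2e^{u⁴} − e^{u⁵}, u^i_xy = −e^{u^{i−1}} + 2e^{u^i} − e^{u^{i+1}} for i = 5, 6, 7, and u⁸_xy = −e^{u⁷} + 2e^{u⁸}. Let C denote the corresponding 8×8 coefficient matrix (the E₈ Cartan matrix, with rows (2,0,−1,0,0,0,0,0), (0,2,0,−1,0,0,0,0), (−1,0,2,−1,0,0,0,0), (0,−1,−1,2,−1,0,0,0), (0,0,0,−1,2,−1,0,0), (0,0,0,0,−1,2,−1,0), (0,0,0,0,0,−1,2,−1), (0,0,0,0,0,0,−1,2)). Let J₈ be the 8×8 upper-triangular all-ones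 matrix, P₂ the 8×8 matrix equal to the identity except that its third row is (0,−1,1,0,0,0,0,0) and its fourth row is (0,1,−1,1,0,0,0,0), and A₂ = J₈⁻¹·P₂⁻¹. Let U = diag(e^{u¹},…,e^{u⁸}), R₁ = diag(∂_yu¹,…,∂_yu⁸), S₂ = diag(0, e^{u¹+u³}, e^{u²+u⁴}, e^{u³+u⁴}, e^{u⁴+u⁵}, e^{u⁵+u⁶}, e^{u⁶+u⁷}, e^{u⁷+u⁸}), and let Z₂ be the 8×8 matrix with first row zero and rows 2–8 equal to (−e^{u³},0,e^{u¹},0,0,0,0,0), (0,−e^{u⁴},0,e^{u²},0,0,0,0), (0,0,−e^{u⁴},e^{u³},0,0,0,0), (0,0,0,−e^{u⁵},e^{u⁴},0,0,0), (0,0,0,0,−e^{u⁶},e^{u⁵},0,0), (0,0,0,0,0,−e^{u⁷},e^{u⁶},0), (0,0,0,0,0,0,−e^{u⁸},e^{u⁷}). Define H₂ := ∂_x(−C·R₁·C⁻¹) + C·U (∂_x entrywise). Then at every point H₂ = C·A₂·Z₂·C⁻¹ and X₂ := H₂·(C·U) = C·A₂·S₂·A₂ᵀ. -/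
open Matrix

noncomputable section

/-- The Cartan matrix `E₈` (in the ordering used in the paper). -/
def E8M : Matrix (Fin 8) (Fin 8) ℝ :=
  !![2, 0, -1, 0, 0, 0, 0, 0;
     0, 2, 0, -1, 0, 0, 0, 0;
     -1, 0, 2, -1, 0, 0, 0, 0;
     0, -1, -1, 2, -1, 0, 0, 0;
     0, 0, 0, -1, 2, -1, 0, 0;
     0, 0, 0, 0, -1, 2, -1, 0;
     0, 0, 0, 0, 0, -1, 2, -1;
     0, 0, 0, 0, 0, 0, -1, 2]

/-- The `8 × 8` upper-triangular all-ones matrix `J₈`. -/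
def J8 : Matrix (Fin 8) (Fin 8) ℝ := Matrix.of fun i j => if i ≤ j then 1 else 0

/-- The matrix `P₂` for `E₈`. -/
def P2e8 : Matrix (Fin 8) (Fin 8) ℝ :=
  !![1, 0, 0, 0, 0, 0, 0, 0;
     0, 1, 0, 0, 0, 0, 0, 0;
     0, -1, 1, 0, 0, 0, 0, 0;
     0, 1, -1, 1, 0, 0, 0, 0;
     0, 0, 0, 0, 1, 0, 0, 0;
     0, 0, 0, 0, 0, 1, 0, 0;
     0, 0, 0, 0, 0, 0, 1, 0;
     0, 0, 0, 0, 0, 0, 0, 1]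

/-- `A₂ = J₈⁻¹·P₂⁻¹`. -/
def A2e8 : Matrix (Fin 8) (Fin 8) ℝ := J8⁻¹ * P2e8⁻¹

theorem contDiff_dy {f : ℝ × ℝ → ℝ} (hf : ContDiff ℝ (⊤ : ℕ∞) f) :
    ContDiff ℝ (⊤ : ℕ∞) (dy f) := by
  have hdy : dy f = fun q => fderiv ℝ f q (0, 1) := by
    funext q
    have hf' : HasFDerivAt f (fderiv ℝ f q) (q.1, q.2) :=
      (hf.differentiable (by simp) q).hasFDerivAt
    exact (hf'.comp_hasDerivAt q.2 ((hasDerivAt_const q.2 q.1).prodMk (hasDerivAt_id q.2))).deriv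
  rw [hdy]
  exact (hf.fderiv_right (by simp)).clm_apply contDiff_const

theorem dxMat_neg_mul_diagonal_mul {n : ℕ} (A B : Matrix (Fin n) (Fin n) ℝ)
    (v : ℝ × ℝ → Fin n → ℝ) (w : Fin n → ℝ) (p : ℝ × ℝ)
    (hv : ∀ k, HasDerivAt (fun s => v (s, p.2) k) (w k) p.1) :
    dxMat (fun q => -(A * diagonal (v q) * B)) p = -(A * diagonal w * B) := by
  ext i j
  simp only [dxMat, of_apply, Matrix.neg_apply, mul_apply (M := A * diagonal _),
    mul_diagonal]
  exact (HasDerivAt.fun_sum fun k _ =>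
    ((hv k).const_mul (A i k)).mul_const (B k j)).fun_neg.deriv

theorem isUnit_det_E8M : IsUnit E8M.det := by
  refine isUnit_det_of_right_inverse (B :=
    !![4, 5, 7, 10, 8, 6, 4, 2;
       5, 8, 10, 15, 12, 9, 6, 3;
       7, 10, 14, 20, 16, 12, 8, 4;
       10, 15, 20, 30, 24, 18, 12, 6;
       8, 12, 16, 24, 20, 15, 10, 5;
       6, 9, 12, 18, 15, 12, 8, 4;
       4, 6, 8, 12, 10, 8, 6, 3;
       2, 3, 4, 6, 5, 4, 3, 2]) ?_
  ext i j
  fin_cases i <;> fin_cases j <;>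
    norm_num [E8M, mul_apply, Fin.sum_univ_succ, one_apply, Fin.ext_iff]

theorem J8_apply (i j : Fin 8) : J8 i j = if i ≤ j then 1 else 0 := rfl

theorem P2e8_mul_J8 : P2e8 * J8 =
    !![1, 1, 1, 1, 1, 1, 1, 1;
       0, 1, 1, 1, 1, 1, 1, 1;
       0, -1, 0, 0, 0, 0, 0, 0;
       0, 1, 0, 1, 1, 1, 1, 1;
       0, 0, 0, 0, 1, 1, 1, 1;
       0, 0, 0, 0, 0, 1, 1, 1;
       0, 0, 0, 0, 0, 0, 1, 1;
       0, 0, 0, 0, 0, 0, 0, 1] := by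
  ext i j
  simp only [mul_apply, Fin.sum_univ_eight, J8_apply]
  fin_cases i <;> fin_cases j <;> simp [P2e8]

theorem A2e8_eq : A2e8 =
    !![1, -1, 0, 0, 0, 0, 0, 0;
       0, 0, -1, 0, 0, 0, 0, 0;
       0, 1, 0, -1, 0, 0, 0, 0;
       0, 0, 1, 1, -1, 0, 0, 0;
       0, 0, 0, 0, 1, -1, 0, 0;
       0, 0, 0, 0, 0, 1, -1, 0;
       0, 0, 0, 0, 0, 0, 1, -1;
       0, 0, 0, 0, 0, 0, 0, 1] := by
  rw [A2e8, ← Matrix.mul_inv_rev, P2e8_mul_J8]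
  refine inv_eq_right_inv ?_
  ext i j
  fin_cases i <;> fin_cases j <;>
    simp [mul_apply, Fin.sum_univ_eight]

/-- The matrix `Z₂` for `E₈`, with `a i` in place of `e^{uⁱ}`. -/
def Z2e8 (a1 a2 a3 a4 a5 a6 a7 a8 : ℝ) : Matrix (Fin 8) (Fin 8) ℝ :=
  !![0, 0, 0, 0, 0, 0, 0, 0;
     -a3, 0, a1, 0, 0, 0, 0, 0;
     0, -a4, 0, a2, 0, 0, 0, 0;
     0, 0, -a4, a3, 0, 0, 0, 0;
     0, 0, 0, -a5, a4, 0, 0, 0;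
     0, 0, 0, 0, -a6, a5, 0, 0;
     0, 0, 0, 0, 0, -a7, a6, 0;
     0, 0, 0, 0, 0, 0, -a8, a7]

theorem A2e8_mul_Z2e8 (a1 a2 a3 a4 a5 a6 a7 a8 : ℝ) :
    A2e8 * Z2e8 a1 a2 a3 a4 a5 a6 a7 a8 =
      diagonal ![a1, a2, a3, a4, a5, a6, a7, a8] * E8M -
        diagonal ![2 * a1 - a3, 2 * a2 - a4, -a1 + 2 * a3 - a4, -a2 - a3 + 2 * a4 - a5,
          -a4 + 2 * a5 - a6, -a5 + 2 * a6 - a7, -a6 + 2 * a7 - a8, -a7 + 2 * a8] := by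
  rw [A2e8_eq]
  ext i j
  rw [Matrix.sub_apply, diagonal_mul, mul_apply, diagonal_apply]
  fin_cases i <;> fin_cases j <;> simp [Z2e8, E8M, Fin.sum_univ_succ, Fin.ext_iff] <;> ring

theorem Z2e8_mul_diagonal (a1 a2 a3 a4 a5 a6 a7 a8 : ℝ) :
    Z2e8 a1 a2 a3 a4 a5 a6 a7 a8 * diagonal ![a1, a2, a3, a4, a5, a6, a7, a8] =
      diagonal ![0, a1 * a3, a2 * a4, a3 * a4, a4 * a5, a5 * a6, a6 * a7, a7 * a8] * A2e8ᵀ := by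
  rw [A2e8_eq]
  ext i j
  rw [diagonal_mul, mul_diagonal, transpose_apply]
  fin_cases i <;> fin_cases j <;> simp [Z2e8, mul_comm]

/-- For smooth solutions of the `E₈` Toda lattice, `H₂ = ∂_x(−CR₁C⁻¹) + CU` equals
`C·A₂·Z₂·C⁻¹` and `X₂ = H₂·(CU) = C·A₂·S₂·A₂ᵀ`. -/
theorem e8_second_laplace_invariant
    (u1 u2 u3 u4 u5 u6 u7 u8 : ℝ × ℝ → ℝ)
    (hu1 : ContDiff ℝ (⊤ : ℕ∞) u1) (hu2 : ContDiff ℝ (⊤ : ℕ∞) u2) (hu3 : ContDiff ℝ (⊤ : ℕ∞) u3)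
    (hu4 : ContDiff ℝ (⊤ : ℕ∞) u4) (hu5 : ContDiff ℝ (⊤ : ℕ∞) u5) (hu6 : ContDiff ℝ (⊤ : ℕ∞) u6)
    (hu7 : ContDiff ℝ (⊤ : ℕ∞) u7) (hu8 : ContDiff ℝ (⊤ : ℕ∞) u8)
    (hpde1 : ∀ x y : ℝ, deriv (fun s => deriv (fun t => u1 (s, t)) y) x =
      2 * Real.exp (u1 (x, y)) - Real.exp (u3 (x, y)))
    (hpde2 : ∀ x y : ℝ, deriv (fun s => deriv (fun t => u2 (s, t)) y) x =
      2 * Real.exp (u2 (x, y)) - Real.exp (u4 (x, y)))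
    (hpde3 : ∀ x y : ℝ, deriv (fun s => deriv (fun t => u3 (s, t)) y) x =
      -Real.exp (u1 (x, y)) + 2 * Real.exp (u3 (x, y)) - Real.exp (u4 (x, y)))
    (hpde4 : ∀ x y : ℝ, deriv (fun s => deriv (fun t => u4 (s, t)) y) x =
      -Real.exp (u2 (x, y)) - Real.exp (u3 (x, y)) + 2 * Real.exp (u4 (x, y)) -
        Real.exp (u5 (x, y)))
    (hpde5 : ∀ x y : ℝ, deriv (fun s => deriv (fun t => u5 (s, t)) y) x =
      -Real.exp (u4 (x, y)) + 2 * Real.exp (u5 (x, y)) - Real.exp (u6 (x, y)))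
    (hpde6 : ∀ x y : ℝ, deriv (fun s => deriv (fun t => u6 (s, t)) y) x =
      -Real.exp (u5 (x, y)) + 2 * Real.exp (u6 (x, y)) - Real.exp (u7 (x, y)))
    (hpde7 : ∀ x y : ℝ, deriv (fun s => deriv (fun t => u7 (s, t)) y) x =
      -Real.exp (u6 (x, y)) + 2 * Real.exp (u7 (x, y)) - Real.exp (u8 (x, y)))
    (hpde8 : ∀ x y : ℝ, deriv (fun s => deriv (fun t => u8 (s, t)) y) x =
      -Real.exp (u7 (x, y)) + 2 * Real.exp (u8 (x, y))) :
    ∀ p : ℝ × ℝ,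
      dxMat (fun q =>
          -(E8M * Matrix.diagonal ![dy u1 q, dy u2 q, dy u3 q, dy u4 q,
              dy u5 q, dy u6 q, dy u7 q, dy u8 q] * E8M⁻¹)) p +
          E8M * Matrix.diagonal ![Real.exp (u1 p), Real.exp (u2 p), Real.exp (u3 p),
            Real.exp (u4 p), Real.exp (u5 p), Real.exp (u6 p), Real.exp (u7 p),
            Real.exp (u8 p)] =
        E8M * A2e8 *
          !![0, 0, 0, 0, 0, 0, 0, 0;
             -Real.exp (u3 p), 0, Real.exp (u1 p), 0, 0, 0, 0, 0;
             0, -Real.exp (u4 p), 0, Real.exp (u2 p), 0, 0, 0, 0;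
             0, 0, -Real.exp (u4 p), Real.exp (u3 p), 0, 0, 0, 0;
             0, 0, 0, -Real.exp (u5 p), Real.exp (u4 p), 0, 0, 0;
             0, 0, 0, 0, -Real.exp (u6 p), Real.exp (u5 p), 0, 0;
             0, 0, 0, 0, 0, -Real.exp (u7 p), Real.exp (u6 p), 0;
             0, 0, 0, 0, 0, 0, -Real.exp (u8 p), Real.exp (u7 p)] * E8M⁻¹ ∧
      (dxMat (fun q =>
          -(E8M * Matrix.diagonal ![dy u1 q, dy u2 q, dy u3 q, dy u4 q,
              dy u5 q, dy u6 q, dy u7 q, dy u8 q] * E8M⁻¹)) p +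
          E8M * Matrix.diagonal ![Real.exp (u1 p), Real.exp (u2 p), Real.exp (u3 p),
            Real.exp (u4 p), Real.exp (u5 p), Real.exp (u6 p), Real.exp (u7 p),
            Real.exp (u8 p)]) *
          (E8M * Matrix.diagonal ![Real.exp (u1 p), Real.exp (u2 p), Real.exp (u3 p),
            Real.exp (u4 p), Real.exp (u5 p), Real.exp (u6 p), Real.exp (u7 p),
            Real.exp (u8 p)]) =
        E8M * A2e8 *
          Matrix.diagonal ![0, Real.exp (u1 p + u3 p), Real.exp (u2 p + u4 p),
            Real.exp (u3 p + u4 p), Real.exp (u4 p + u5 p), Real.exp (u5 p + u6 p),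
            Real.exp (u6 p + u7 p), Real.exp (u7 p + u8 p)] * A2e8ᵀ := by
  intro p
  have hasDerivAt_dy {f : ℝ × ℝ → ℝ} (hf : ContDiff ℝ (⊤ : ℕ∞) f) {c : ℝ}
      (hc : deriv (fun s => deriv (fun t => f (s, t)) p.2) p.1 = c) :
      HasDerivAt (fun s => dy f (s, p.2)) c p.1 := by
    rw [← hc]
    have hd : Differentiable ℝ (dy f) := (contDiff_dy hf).differentiable (by simp)
    have : Differentiable ℝ fun s => dy f (s, p.2) := by fun_prop
    exact (this p.1).hasDerivAt
  rw [dxMat_neg_mul_diagonal_mul E8M E8M⁻¹ _ ![_, _, _, _, _, _, _, _] p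
    (Fin.forall_fin_succ.2 ⟨hasDerivAt_dy hu1 (hpde1 _ _),
     Fin.forall_fin_succ.2 ⟨hasDerivAt_dy hu2 (hpde2 _ _),
     Fin.forall_fin_succ.2 ⟨hasDerivAt_dy hu3 (hpde3 _ _),
     Fin.forall_fin_succ.2 ⟨hasDerivAt_dy hu4 (hpde4 _ _),
     Fin.forall_fin_succ.2 ⟨hasDerivAt_dy hu5 (hpde5 _ _),
     Fin.forall_fin_succ.2 ⟨hasDerivAt_dy hu6 (hpde6 _ _),
     Fin.forall_fin_succ.2 ⟨hasDerivAt_dy hu7 (hpde7 _ _),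
     Fin.forall_fin_succ.2 ⟨hasDerivAt_dy hu8 (hpde8 _ _), finZeroElim⟩⟩⟩⟩⟩⟩⟩⟩)]
  simp only [Prod.mk.eta, Real.exp_add]
  generalize Real.exp (u1 p) = a1, Real.exp (u2 p) = a2, Real.exp (u3 p) = a3,
    Real.exp (u4 p) = a4, Real.exp (u5 p) = a5, Real.exp (u6 p) = a6,
    Real.exp (u7 p) = a7, Real.exp (u8 p) = a8
  rw [← Z2e8]
  have hinv := isUnit_det_E8M
  rw [and_iff_left_of_imp fun h => ?_]
  · rw [Matrix.mul_assoc E8M A2e8, A2e8_mul_Z2e8, Matrix.mul_sub, Matrix.sub_mul,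
      ← Matrix.mul_assoc E8M, mul_nonsing_inv_cancel_right _ _ hinv, neg_add_eq_sub]
  · rw [h, Matrix.mul_assoc, nonsing_inv_mul_cancel_left _ _ hinv,
      Matrix.mul_assoc (E8M * A2e8), Z2e8_mul_diagonal, ← Matrix.mul_assoc]

end
end
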